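/- For all ε > 0 and κ > 0 there exists a constant C(ε,κ) such that the following holds: for every real symmetric positive definite 2×2 matrix A = [[a, b],[b, c]] that is Minkowski-reduced (i.e. 2|b| ≤ a ≤ c), the number of matrices U ∈ GL(2,ℤ) with tr(ᵗU A U) ≤ κ · det A is at most C(ε,κ) · (det A)^{1/2+ε}. -/

import Mathlib

open Matrix

/-- Integral `2 × 2` matrices of determinant `±1` whose top row is bounded by `M` and bottom row
by `N`. -/
def boundedUnimodular (M N : ℕ) : Set (Matrix (Fin 2) (Fin 2) ℤ) :=
  {U | (U.det = 1 ∨ U.det = -1) ∧ (∀ j, |U 0 j| ≤ M) ∧ ∀ j, |U 1 j| ≤ N}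

/-- The members of `boundedUnimodular M N` whose bottom row has its largest entry on the left. -/
def leftDominant (M N : ℕ) : Set (Matrix (Fin 2) (Fin 2) ℤ) :=
  {U | U ∈ boundedUnimodular M N ∧ |U 1 1| ≤ |U 1 0|}

/-- An encoding that is injective on `leftDominant M N`: its last entry has the quotient of `U 0 0`
and the remainder of `U 1 1` modulo `|U 1 0|`. -/
def unimodularCode (U : Matrix (Fin 2) (Fin 2) ℤ) : ℤ × ℤ × ℤ × ℤ :=
  (U 1 0, U.det, U 1 1 / |U 1 0|, U 0 0 / |U 1 0| * |U 1 0| + U 1 1 % |U 1 0|)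

/-- A box that contains the codes of `leftDominant M N` when `N ≤ M`. -/
noncomputable def unimodularCodeRange (M N : ℕ) : Finset (ℤ × ℤ × ℤ × ℤ) :=
  Finset.Icc (-N : ℤ) N ×ˢ {1, -1} ×ˢ Finset.Icc (-1) 1 ×ˢ Finset.Icc (-(2 * M) : ℤ) (2 * M)

theorem card_unimodularCodeRange (M N : ℕ) :
    (unimodularCodeRange M N).card = (2 * N + 1) * (2 * (3 * (4 * M + 1))) := by
  have h1 : ((N : ℤ) + 1 - -N).toNat = 2 * N + 1 := by omega
  have h2 : ((2 * M : ℤ) + 1 - -(2 * M)).toNat = 4 * M + 1 := by omega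
  have h3 : ({1, -1} : Finset ℤ).card = 2 := by decide
  simp only [unimodularCodeRange, Finset.card_product, Int.card_Icc, h1, h2, h3]
  rfl

theorem leftDominant.pos {M N : ℕ} {U : Matrix (Fin 2) (Fin 2) ℤ} (hU : U ∈ leftDominant M N) :
    0 < |U 1 0| := by
  obtain ⟨⟨hdet, -, -⟩, hle⟩ := hU
  rw [abs_pos]
  intro h0
  have h1 : U 1 1 = 0 := by simpa [h0] using hle
  simp [det_fin_two, h0, h1] at hdet

theorem mapsTo_unimodularCode {M N : ℕ} (hNM : N ≤ M) :
    Set.MapsTo unimodularCode (leftDominant M N) (unimodularCodeRange M N) := by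
  intro U hU
  have hpos := leftDominant.pos hU
  obtain ⟨⟨hdet, htop, hbot⟩, hle⟩ := hU
  have h0 := hbot 0
  have hx := abs_le.mp (htop 0)
  have hy := abs_le.mp hle
  have hdiv := Int.mul_ediv_add_emod (U 0 0) |U 1 0|
  have hmod0 := Int.emod_nonneg (U 0 0) hpos.ne'
  have hmod1 := Int.emod_lt_of_pos (U 0 0) hpos
  have hmod0' := Int.emod_nonneg (U 1 1) hpos.ne'
  have hmod1' := Int.emod_lt_of_pos (U 1 1) hpos
  simp only [unimodularCode, unimodularCodeRange, Finset.coe_product, Set.mem_prod,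
    Finset.coe_Icc, Set.mem_Icc, Finset.mem_coe, Finset.mem_insert, Finset.mem_singleton]
  rw [mul_comm] at hdiv
  refine ⟨abs_le.mp h0, hdet, ⟨?_, ?_⟩, ?_, ?_⟩
  · rw [Int.le_ediv_iff_mul_le hpos]; linarith
  · exact Int.lt_add_one_iff.mp (by rw [Int.ediv_lt_iff_lt_mul hpos]; linarith)
  · omega
  · omega

theorem injOn_unimodularCode (M N : ℕ) : Set.InjOn unimodularCode (leftDominant M N) := by
  intro U hU V hV h
  have hpos := leftDominant.pos hU
  have hdet := hU.1.1
  simp only [unimodularCode, Prod.mk.injEq] at h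
  obtain ⟨h10, hdetUV, hq, hw⟩ := h
  rw [← h10] at hq hw
  generalize hm : |U 1 0| = m at *
  have hquot : ∀ p r : ℤ, (p * m + r % m) / m = p := fun p r => by
    rw [add_comm, Int.add_mul_ediv_right _ _ hpos.ne',
      Int.ediv_eq_zero_of_lt (Int.emod_nonneg r hpos.ne') (Int.emod_lt_of_pos r hpos), zero_add]
  have hp : U 0 0 / m = V 0 0 / m := by
    simpa only [hquot] using congrArg (· / m) hw
  have hr : U 1 1 % m = V 1 1 % m := by
    rw [hp] at hw
    exact add_left_cancel hw
  have h11 : U 1 1 = V 1 1 := by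
    rw [← Int.mul_ediv_add_emod (U 1 1) m, hq, hr, Int.mul_ediv_add_emod]
  rw [det_fin_two] at hdet
  simp only [det_fin_two, ← h10, ← h11] at hdetUV
  have hcop : IsCoprime (U 1 0) (U 1 1) := by
    rcases hdet with hd | hd
    · exact ⟨-U 0 1, U 0 0, by linarith⟩
    · exact ⟨U 0 1, -U 0 0, by linarith⟩
  have hdvd : m ∣ V 0 0 - U 0 0 := by
    rw [← hm, abs_dvd]
    exact hcop.dvd_of_dvd_mul_right ⟨V 0 1 - U 0 1, by linarith⟩
  have hmod : U 0 0 % m = V 0 0 % m := Int.modEq_iff_dvd.mpr hdvd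
  have h00 : U 0 0 = V 0 0 := by
    rw [← Int.mul_ediv_add_emod (U 0 0) m, hp, hmod, Int.mul_ediv_add_emod]
  have hne : U 1 0 ≠ 0 := by
    rw [← abs_pos, hm]; exact hpos
  have h01 : U 0 1 = V 0 1 := by
    rw [← h00] at hdetUV
    exact mul_right_cancel₀ hne (by linarith)
  ext i j
  fin_cases i <;> fin_cases j <;> assumption

theorem boundedUnimodular_subset (M N : ℕ) :
    boundedUnimodular M N ⊆ leftDominant M N ∪
      (fun U => U.submatrix id (Equiv.swap 0 1)) '' leftDominant M N := by
  intro U hU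
  rcases le_total |U 1 1| |U 1 0| with h | h
  · exact Or.inl ⟨hU, h⟩
  · refine Or.inr ⟨U.submatrix id (Equiv.swap 0 1), ⟨⟨?_, fun j => hU.2.1 _, fun j => hU.2.2 _⟩, ?_⟩,
      ?_⟩
    · have hd := hU.1
      simp only [det_fin_two, submatrix_apply, id, Equiv.swap_apply_left,
        Equiv.swap_apply_right] at hd ⊢
      rcases hd with hd | hd
      · right; linarith
      · left; linarith
    · simpa using h
    · ext i j
      simp

theorem boundedUnimodular_finite_ncard_le {M N : ℕ} (hNM : N ≤ M) :
    (boundedUnimodular M N).Finite ∧ (boundedUnimodular M N).ncard ≤ 180 * (N * M) := by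
  have hfin : (leftDominant M N).Finite :=
    Set.Finite.of_injOn (mapsTo_unimodularCode hNM) (injOn_unimodularCode M N)
      (Finset.finite_toSet _)
  have hunion := hfin.union (hfin.image fun U => U.submatrix id (Equiv.swap 0 1))
  refine ⟨hunion.subset (boundedUnimodular_subset M N), ?_⟩
  rcases Nat.eq_zero_or_pos N with rfl | hN
  · have : boundedUnimodular M 0 = ∅ := by
      refine Set.eq_empty_of_forall_notMem fun U hU => ?_
      obtain ⟨hd, -, hb⟩ := hU
      simp only [Nat.cast_zero, abs_nonpos_iff] at hb
      simp [det_fin_two, hb] at hd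
    simp [this]
  have hleft : (leftDominant M N).ncard ≤ (2 * N + 1) * (2 * (3 * (4 * M + 1))) := by
    rw [← card_unimodularCodeRange, ← Set.ncard_coe_finset]
    exact Set.ncard_le_ncard_of_injOn _ (mapsTo_unimodularCode hNM) (injOn_unimodularCode M N)
      (Finset.finite_toSet _)
  have hbound : (2 * N + 1) * (2 * (3 * (4 * M + 1))) ≤ 90 * (N * M) := by
    nlinarith [Nat.mul_le_mul (show 2 * N + 1 ≤ 3 * N by omega)
      (show 4 * M + 1 ≤ 5 * M by omega)]
  have h1 := Set.ncard_le_ncard (boundedUnimodular_subset M N) hunion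
  have h2 := Set.ncard_union_le (leftDominant M N)
    ((fun U => U.submatrix id (Equiv.swap 0 1)) '' leftDominant M N)
  have h3 := Set.ncard_image_le hfin
    (f := fun U : Matrix (Fin 2) (Fin 2) ℤ => U.submatrix id (Equiv.swap 0 1))
  omega

theorem half_diagonal_le_of_reduced {a b c : ℝ} (hb : 2 * |b| ≤ a) (hac : a ≤ c) (x y : ℝ) :
    (a * x ^ 2 + c * y ^ 2) / 2 ≤ a * x ^ 2 + 2 * b * x * y + c * y ^ 2 := by
  have hcross : -(2 * b * x * y) ≤ a * (|x| * |y|) :=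
    calc -(2 * b * x * y) ≤ |2 * b * x * y| := neg_le_abs _
      _ = 2 * |b| * (|x| * |y|) := by simp only [abs_mul, abs_two]; ring
      _ ≤ a * (|x| * |y|) := by gcongr
  have ha : 0 ≤ a := by linarith [abs_nonneg b]
  nlinarith [mul_nonneg ha (sq_nonneg (|x| - |y|)), sq_abs x, sq_abs y,
    mul_nonneg (sub_nonneg.mpr hac) (sq_nonneg y)]

theorem abs_le_sqrt_floor {r : ℝ} {x : ℤ} (h : (x : ℝ) ^ 2 ≤ r) : |x| ≤ (Nat.sqrt ⌊r⌋₊ : ℕ) := by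
  rw [Int.abs_eq_natAbs, Nat.cast_le, Nat.le_sqrt', Nat.le_floor_iff ((sq_nonneg _).trans h)]
  have : ((x.natAbs : ℕ) : ℝ) ^ 2 = (x : ℝ) ^ 2 := by
    rw [Nat.cast_natAbs, Int.cast_abs, sq_abs]
  rw [Nat.cast_pow, this]
  exact h

theorem sqrt_floor_sq_le {r : ℝ} (hr : 0 ≤ r) : ((Nat.sqrt ⌊r⌋₊ : ℕ) : ℝ) ^ 2 ≤ r :=
  le_trans (mod_cast Nat.sqrt_le' _) (Nat.floor_le hr)

theorem natCast_le_rpow {n : ℕ} {t ε : ℝ} (hε : 0 ≤ ε) (h : (n : ℝ) ^ 2 ≤ t) :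
    (n : ℝ) ≤ t ^ ((1 : ℝ) / 2 + ε) := by
  have ht : 0 ≤ t := (sq_nonneg _).trans h
  rcases Nat.eq_zero_or_pos n with rfl | hn
  · simpa using Real.rpow_nonneg ht _
  have h1 : (1 : ℝ) ≤ n := mod_cast hn
  calc (n : ℝ) ≤ √t := Real.le_sqrt_of_sq_le h
    _ = t ^ ((1 : ℝ) / 2) := Real.sqrt_eq_rpow t
    _ ≤ t ^ ((1 : ℝ) / 2 + ε) := by
      apply Real.rpow_le_rpow_of_exponent_le <;> nlinarith

theorem trace_transpose_mul_mul_fin_two {A : Matrix (Fin 2) (Fin 2) ℝ} (hA : A 1 0 = A 0 1)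
    (V : Matrix (Fin 2) (Fin 2) ℝ) :
    Matrix.trace (Vᵀ * A * V) =
      (A 0 0 * V 0 0 ^ 2 + 2 * A 0 1 * V 0 0 * V 1 0 + A 1 1 * V 1 0 ^ 2) +
      (A 0 0 * V 0 1 ^ 2 + 2 * A 0 1 * V 0 1 * V 1 1 + A 1 1 * V 1 1 ^ 2) := by
  simp only [trace_fin_two, mul_apply, Fin.sum_univ_two, transpose_apply, hA]
  ring

/-- For all `ε > 0` and `κ > 0` there is a constant `C(ε,κ)` such that for every
Minkowski-reduced real symmetric positive definite 2×2 matrix `A = [[a,b],[b,c]]`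
(i.e. `2|b| ≤ a ≤ c`), the number of `U ∈ GL(2,ℤ)` with `tr(ᵀU A U) ≤ κ det A` is at
most `C(ε,κ) (det A)^{1/2+ε}`. -/
theorem count_trace_small_le (ε κ : ℝ) (hε : 0 < ε) (hκ : 0 < κ) :
    ∃ C : ℝ, ∀ A : Matrix (Fin 2) (Fin 2) ℝ, Aᵀ = A → A.PosDef →
      2 * |A 0 1| ≤ A 0 0 → A 0 0 ≤ A 1 1 →
      {U : Matrix (Fin 2) (Fin 2) ℤ | (U.det = 1 ∨ U.det = -1) ∧
        Matrix.trace ((U.map (Int.cast : ℤ → ℝ))ᵀ * A * U.map (Int.cast : ℤ → ℝ))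
          ≤ κ * A.det}.Finite ∧
      (Nat.card {U : Matrix (Fin 2) (Fin 2) ℤ | (U.det = 1 ∨ U.det = -1) ∧
          Matrix.trace ((U.map (Int.cast : ℤ → ℝ))ᵀ * A * U.map (Int.cast : ℤ → ℝ))
            ≤ κ * A.det} : ℝ)
        ≤ C * A.det ^ ((1 : ℝ) / 2 + ε) := by
  refine ⟨180 * (16 * κ ^ 2 / 3) ^ ((1 : ℝ) / 2 + ε), fun A hsymm hpos hb hac => ?_⟩
  have h10 : A 1 0 = A 0 1 := congrFun (congrFun hsymm 0) 1
  have ha : 0 < A 0 0 := hpos.diag_pos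
  have hc : 0 < A 1 1 := ha.trans_le hac
  have hdet : A.det = A 0 0 * A 1 1 - A 0 1 ^ 2 := by rw [det_fin_two, h10]; ring
  have hdet_le : A.det ≤ A 0 0 * A 1 1 := by linarith [sq_nonneg (A 0 1)]
  have hle_det : 3 * (A 0 0 * A 1 1) ≤ 4 * A.det := by
    have hsq : (2 * |A 0 1|) ^ 2 ≤ A 0 0 ^ 2 := by gcongr
    rw [mul_pow, sq_abs] at hsq
    nlinarith
  set M := Nat.sqrt ⌊2 * κ * A 1 1⌋₊
  set N := Nat.sqrt ⌊2 * κ * A 0 0⌋₊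
  have hNM : N ≤ M := Nat.sqrt_le_sqrt (Nat.floor_mono (by gcongr))
  obtain ⟨hfin, hcard⟩ := boundedUnimodular_finite_ncard_le hNM
  have hsub : {U : Matrix (Fin 2) (Fin 2) ℤ | (U.det = 1 ∨ U.det = -1) ∧
      Matrix.trace ((U.map (Int.cast : ℤ → ℝ))ᵀ * A * U.map (Int.cast : ℤ → ℝ))
        ≤ κ * A.det} ⊆ boundedUnimodular M N := by
    rintro U ⟨hU, htr⟩
    rw [trace_transpose_mul_mul_fin_two h10] at htr
    simp only [map_apply] at htr
    have h0 := half_diagonal_le_of_reduced hb hac (U 0 0) (U 1 0)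
    have h1 := half_diagonal_le_of_reduced hb hac (U 0 1) (U 1 1)
    have hκdet := mul_le_mul_of_nonneg_left hdet_le hκ.le
    have hx0 := mul_nonneg ha.le (sq_nonneg (U 0 0 : ℝ))
    have hx1 := mul_nonneg ha.le (sq_nonneg (U 0 1 : ℝ))
    have hy0 := mul_nonneg hc.le (sq_nonneg (U 1 0 : ℝ))
    have hy1 := mul_nonneg hc.le (sq_nonneg (U 1 1 : ℝ))
    refine ⟨hU, Fin.forall_fin_two.mpr ⟨?_, ?_⟩, Fin.forall_fin_two.mpr ⟨?_, ?_⟩⟩ <;>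
      apply abs_le_sqrt_floor
    · exact le_of_mul_le_mul_left (by linarith) ha
    · exact le_of_mul_le_mul_left (by linarith) ha
    · exact le_of_mul_le_mul_left (by linarith) hc
    · exact le_of_mul_le_mul_left (by linarith) hc
  refine ⟨hfin.subset hsub, ?_⟩
  have hNMsq : ((N * M : ℕ) : ℝ) ^ 2 ≤ 16 * κ ^ 2 / 3 * A.det := by
    rw [Nat.cast_mul, mul_pow]
    calc (N : ℝ) ^ 2 * (M : ℝ) ^ 2 ≤ (2 * κ * A 0 0) * (2 * κ * A 1 1) := by
          gcongr
          · exact sqrt_floor_sq_le (by positivity)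
          · exact sqrt_floor_sq_le (by positivity)
      _ ≤ 16 * κ ^ 2 / 3 * A.det := by
          nlinarith [mul_le_mul_of_nonneg_left hle_det (sq_nonneg κ)]
  rw [Nat.card_coe_set_eq, mul_assoc, ← Real.mul_rpow (by positivity) hpos.det_pos.le]
  calc _ ≤ ((180 * (N * M) : ℕ) : ℝ) :=
        Nat.cast_le.mpr ((Set.ncard_le_ncard hsub hfin).trans hcard)
    _ = 180 * ((N * M : ℕ) : ℝ) := by push_cast; ring
    _ ≤ _ := by gcongr; exact natCast_le_rpow hε.le hNMsq
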